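/- Let X and Y be uniform spaces, let μ₀ ∈ Meas(X) be a positive uniform measure and let ν₀ ∈ Meas(Y) be positive. Then for every finite set F of semiuniform functions f : X × Y → ℝ and every ε > 0 there exist finite sets H₁ ⊆ Ub(X) and H₂ ⊆ Ub(Y) and δ > 0 such that for all positive μ ∈ Meas(X) and positive ν ∈ Meas(Y) satisfying |μ(h) − μ₀(h)| < δ for all h ∈ H₁ and |ν(h) − ν₀(h)| < δ for all h ∈ H₂, one has |(μ ⊗ ν)(f) − (μ₀ ⊗ ν₀)(f)| < ε for all f ∈ F. (That is, on positive functionals the direct product is jointly weak-* continuous at (μ₀, ν₀).) -/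

import Mathlib

noncomputable section

open Filter Topology

/-- `f` is a bounded uniformly continuous real-valued function,
i.e. a member of `Ub(X)`. -/
def IsUb {X : Type*} [UniformSpace X] (f : X → ℝ) : Prop :=
  UniformContinuous f ∧ ∃ C : ℝ, ∀ x, |f x| ≤ C

/-- Supremum norm of a real-valued function. -/
def supNorm {α : Type*} (f : α → ℝ) : ℝ :=
  sSup (Set.range fun x => |f x|)

/-- `μ` is (the restriction to `Ub(X)` of) a norm-continuous linear functional on `Ub(X)`,
i.e. a member of `Meas(X)`.  It is represented as a bare map on all functions;
only its values on `Ub(X)` are relevant. -/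
def IsMeas {X : Type*} [UniformSpace X] (μ : (X → ℝ) → ℝ) : Prop :=
  (∀ f g : X → ℝ, IsUb f → IsUb g → μ (f + g) = μ f + μ g) ∧
  (∀ (c : ℝ) (f : X → ℝ), IsUb f → μ (c • f) = c * μ f) ∧
  (∃ C : ℝ, ∀ f : X → ℝ, IsUb f → (∀ x, |f x| ≤ 1) → |μ f| ≤ C)

/-- The dual norm on `Meas(X)`:  `‖μ‖ = sup {|μ f| : f ∈ Ub(X), ‖f‖ ≤ 1}`. -/
def measNorm {X : Type*} [UniformSpace X] (μ : (X → ℝ) → ℝ) : ℝ :=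
  sSup {r : ℝ | ∃ f : X → ℝ, IsUb f ∧ (∀ x, |f x| ≤ 1) ∧ r = |μ f|}

/-- `μ` is a positive functional:  `μ f ≥ 0` whenever `f ∈ Ub(X)` and `f ≥ 0`. -/
def IsPositive {X : Type*} [UniformSpace X] (μ : (X → ℝ) → ℝ) : Prop :=
  ∀ f : X → ℝ, IsUb f → (∀ x, 0 ≤ f x) → 0 ≤ μ f

/-- `μ` is a *uniform measure*: on every norm-bounded uniformly equicontinuous set
`H ⊆ Ub(X)`, `μ` is continuous for the topology of pointwise convergence. -/
def IsUniformMeasure {X : Type*} [UniformSpace X] (μ : (X → ℝ) → ℝ) : Prop :=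
  ∀ H : Set (X → ℝ),
    (∃ C : ℝ, ∀ f ∈ H, ∀ x, |f x| ≤ C) →
    H.UniformEquicontinuous →
    ∀ f₀ ∈ H, ∀ ε : ℝ, 0 < ε →
      ∃ (K : Finset X) (δ : ℝ), 0 < δ ∧
        ∀ f ∈ H, (∀ x ∈ K, |f x - f₀ x| < δ) → |μ f - μ f₀| < ε

/-- A *semiuniform* function on `X × Y`, i.e. a member of `Ub(X ⋉ Y)` where `X ⋉ Y` is the
semiuniform product: `f` is bounded, the family of sections `x ↦ f (x, y)` (for `y ∈ Y`)
is uniformly equicontinuous on `X`, and every section `y ↦ f (x, y)` is uniformly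
continuous on `Y`. -/
def Semiuniform {X Y : Type*} [UniformSpace X] [UniformSpace Y] (f : X × Y → ℝ) : Prop :=
  (∃ C : ℝ, ∀ p, |f p| ≤ C) ∧
  UniformEquicontinuous (fun y : Y => fun x : X => f (x, y)) ∧
  ∀ x : X, UniformContinuous fun y : Y => f (x, y)

/-- The direct product `μ ⊗ ν`, evaluated at `f : X × Y → ℝ`:
`(μ ⊗ ν)(f) = μ (x ↦ ν (y ↦ f (x, y)))`. -/
def dirProd {X Y : Type*} (μ : (X → ℝ) → ℝ) (ν : (Y → ℝ) → ℝ) (f : X × Y → ℝ) : ℝ :=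
  μ fun x => ν fun y => f (x, y)

/-- Convolution: `(μ ⋆ ν)(f) = μ (x ↦ ν (y ↦ f (x · y)))`. -/
def conv {G : Type*} [Mul G] (μ ν : (G → ℝ) → ℝ) : (G → ℝ) → ℝ :=
  fun f => μ fun x => ν fun y => f (x * y)

/-- The weak-* topology on `Meas(X)`: the topology of pointwise convergence on `Ub(X)`. -/
def weakStarMeas (X : Type*) [UniformSpace X] :
    TopologicalSpace {ν : (X → ℝ) → ℝ // IsMeas ν} :=
  TopologicalSpace.induced
    (fun ν => fun f : {f : X → ℝ // IsUb f} => ν.1 f.1) Pi.topologicalSpace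

section IsUb

variable {X : Type*} [UniformSpace X] {f g : X → ℝ}

lemma IsUb.add (hf : IsUb f) (hg : IsUb g) : IsUb (f + g) := by
  obtain ⟨hf, C, hC⟩ := hf
  obtain ⟨hg, D, hD⟩ := hg
  exact ⟨hf.add hg, C + D, fun x => (abs_add_le _ _).trans (add_le_add (hC x) (hD x))⟩

lemma IsUb.const_smul (c : ℝ) (hf : IsUb f) : IsUb (c • f) := by
  obtain ⟨hf, C, hC⟩ := hf
  refine ⟨hf.const_smul c, |c| * C, fun x => ?_⟩
  simpa [abs_mul] using mul_le_mul_of_nonneg_left (hC x) (abs_nonneg c)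

lemma IsUb.sub (hf : IsUb f) (hg : IsUb g) : IsUb (f - g) := by
  simpa [sub_eq_add_neg] using hf.add (hg.const_smul (-1))

lemma isUb_const (c : ℝ) : IsUb (fun _ : X => c) :=
  ⟨uniformContinuous_const, |c|, fun _ => le_rfl⟩

end IsUb

section IsMeas

variable {X : Type*} [UniformSpace X] {μ : (X → ℝ) → ℝ} {f g : X → ℝ}

lemma IsMeas.map_sub (hμ : IsMeas μ) (hf : IsUb f) (hg : IsUb g) : μ (f - g) = μ f - μ g := by
  have h := hμ.1 f ((-1 : ℝ) • g) hf (hg.const_smul _)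
  rw [hμ.2.1 _ g hg] at h
  rw [show f - g = f + (-1 : ℝ) • g by simp [sub_eq_add_neg], h]
  ring

lemma IsMeas.map_zero (hμ : IsMeas μ) : μ 0 = 0 := by
  simpa using hμ.map_sub (isUb_const (X := X) 0) (isUb_const 0)

lemma IsMeas.map_const (hμ : IsMeas μ) (c : ℝ) : μ (fun _ => c) = c * μ (fun _ => 1) := by
  rw [← hμ.2.1 c _ (isUb_const 1)]
  congr 1
  ext
  simp

lemma IsPositive.mono (hpos : IsPositive μ) (hμ : IsMeas μ) (hf : IsUb f) (hg : IsUb g)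
    (h : ∀ x, f x ≤ g x) : μ f ≤ μ g := by
  have := hpos (g - f) (hg.sub hf) fun x => sub_nonneg.2 (h x)
  rw [hμ.map_sub hg hf] at this
  linarith

lemma IsPositive.abs_le (hpos : IsPositive μ) (hμ : IsMeas μ) (hf : IsUb f) (hg : IsUb g)
    (h : ∀ x, |f x| ≤ g x) : |μ f| ≤ μ g := by
  have h₁ := hpos.mono hμ hf hg fun x => (le_abs_self _).trans (h x)
  have h₂ := hpos.mono hμ (hf.const_smul (-1)) hg fun x => by
    simpa using (neg_le_abs _).trans (h x)
  rw [hμ.2.1 _ _ hf] at h₂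
  exact _root_.abs_le.2 ⟨by linarith, h₁⟩

lemma IsPositive.abs_le_mul (hpos : IsPositive μ) (hμ : IsMeas μ) (hf : IsUb f) {r : ℝ}
    (h : ∀ x, |f x| ≤ r) : |μ f| ≤ r * μ (fun _ => 1) :=
  hμ.map_const r ▸ hpos.abs_le hμ hf (isUb_const r) h

end IsMeas

section SectionLipschitz

variable {X Y : Type*} {f : X × Y → ℝ}

/-- The functions `X → [0, B]` that are `L`-Lipschitz for the pseudometric
`d(x, x') = sup_y |f (x, y) - f (x', y)|`. -/
def sectionLipschitz (f : X × Y → ℝ) (B L : ℝ) : Set (X → ℝ) :=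
  {h | (∀ x, 0 ≤ h x ∧ h x ≤ B) ∧
    ∀ x x' r, 0 ≤ r → (∀ y, |f (x, y) - f (x', y)| ≤ r) → |h x - h x'| ≤ L * r}

lemma iSup_mem_sectionLipschitz {B L : ℝ} {S : Set (X → ℝ)} (hne : S.Nonempty)
    (hS : S ⊆ sectionLipschitz f B L) :
    (fun x => ⨆ h : S, h.1 x) ∈ sectionLipschitz f B L := by
  have : Nonempty S := hne.to_subtype
  have hbdd (x : X) : BddAbove (Set.range fun h : S => h.1 x) :=
    ⟨B, by rintro _ ⟨h, rfl⟩; exact ((hS h.2).1 x).2⟩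
  have hle (x x' : X) (r : ℝ) (hr : 0 ≤ r) (hd : ∀ y, |f (x, y) - f (x', y)| ≤ r) :
      ⨆ h : S, h.1 x ≤ (⨆ h : S, h.1 x') + L * r := by
    refine ciSup_le fun h => ?_
    have h₁ := le_of_abs_le ((hS h.2).2 x x' r hr hd)
    have h₂ := le_ciSup (hbdd x') h
    linarith
  refine ⟨fun x => ⟨Real.iSup_nonneg fun h => ((hS h.2).1 x).1,
    ciSup_le fun h => ((hS h.2).1 x).2⟩, fun x x' r hr hd => abs_le.2 ⟨?_, ?_⟩⟩
  · have := hle x' x r hr fun y => abs_sub_comm (f (x, y)) _ ▸ hd y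
    linarith
  · have := hle x x' r hr hd
    linarith

end SectionLipschitz

section Semiuniform

variable {X Y : Type*} [UniformSpace X] [UniformSpace Y] {f : X × Y → ℝ}

lemma Semiuniform.isUb_section (hf : Semiuniform f) (x : X) : IsUb fun y => f (x, y) :=
  ⟨hf.2.2 x, hf.1.imp fun _ hC _ => hC _⟩

lemma Semiuniform.uniformEquicontinuous_sectionLipschitz (hf : Semiuniform f) (B : ℝ) {L : ℝ}
    (hL : 0 < L) : (sectionLipschitz f B L).UniformEquicontinuous := by
  refine Metric.uniformEquicontinuous_iff_right.2 fun ε hε => ?_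
  have hr : 0 < ε / (2 * L) := by positivity
  filter_upwards [Metric.uniformEquicontinuous_iff_right.1 hf.2.1 _ hr] with p hp h
  have := h.2.2 p.1 p.2 _ hr.le fun y => (hp y).le
  rw [show L * (ε / (2 * L)) = ε / 2 by field_simp] at this
  rw [Real.dist_eq]
  exact this.trans_lt (half_lt_self hε)

lemma Semiuniform.isUb_of_mem_sectionLipschitz (hf : Semiuniform f) {B L : ℝ} (hL : 0 < L)
    {h : X → ℝ} (hh : h ∈ sectionLipschitz f B L) : IsUb h :=
  ⟨(hf.uniformEquicontinuous_sectionLipschitz B hL).uniformContinuous ⟨h, hh⟩, B, fun x => by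
    rw [abs_of_nonneg (hh.1 x).1]; exact (hh.1 x).2⟩

variable {ν ν' : (Y → ℝ) → ℝ} {M : ℝ}

lemma Semiuniform.abs_apply_section_sub_le (hf : Semiuniform f) (hν : IsMeas ν)
    (hpos : IsPositive ν) (hM : ν (fun _ => 1) ≤ M) {x x' : X} {r : ℝ} (hr : 0 ≤ r)
    (hd : ∀ y, |f (x, y) - f (x', y)| ≤ r) :
    |ν (fun y => f (x, y)) - ν (fun y => f (x', y))| ≤ M * r := by
  rw [← hν.map_sub (hf.isUb_section x) (hf.isUb_section x'), mul_comm]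
  exact (hpos.abs_le_mul hν ((hf.isUb_section x).sub (hf.isUb_section x')) hd).trans
    (mul_le_mul_of_nonneg_left hM hr)

lemma Semiuniform.isUb_apply_section (hf : Semiuniform f) (hν : IsMeas ν) (hpos : IsPositive ν) :
    IsUb fun x => ν fun y => f (x, y) := by
  obtain ⟨C, hC⟩ := hf.1
  have h1 : 0 ≤ ν (fun _ => 1) := hpos _ (isUb_const 1) fun _ => zero_le_one
  refine ⟨Metric.uniformity_basis_dist.tendsto_right_iff.2 fun ε hε => ?_,
    C * ν (fun _ => 1), fun x => hpos.abs_le_mul hν (hf.isUb_section x) fun y => hC _⟩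
  have hr : 0 < ε / (ν (fun _ => 1) + 1) := by positivity
  filter_upwards [Metric.uniformEquicontinuous_iff_right.1 hf.2.1 _ hr] with p hp
  have := hf.abs_apply_section_sub_le hν hpos le_rfl hr.le fun y => (hp y).le
  refine this.trans_lt ?_
  rw [← mul_div_assoc, div_lt_iff₀ (by positivity)]
  linarith

lemma Semiuniform.abs_sub_mem_sectionLipschitz (hf : Semiuniform f) {C : ℝ} (hC₀ : 0 ≤ C)
    (hC : ∀ p, |f p| ≤ C) (hν : IsMeas ν) (hpos : IsPositive ν) (hM : ν (fun _ => 1) ≤ M)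
    (hν' : IsMeas ν') (hpos' : IsPositive ν') (hM' : ν' (fun _ => 1) ≤ M) :
    (fun x => |ν (fun y => f (x, y)) - ν' (fun y => f (x, y))|) ∈
      sectionLipschitz f (2 * C * M) (2 * M) := by
  refine ⟨fun x => ⟨abs_nonneg _, ?_⟩, fun x x' r hr hd => ?_⟩
  · have h₁ := hpos.abs_le_mul hν (hf.isUb_section x) fun y => hC (x, y)
    have h₂ := hpos'.abs_le_mul hν' (hf.isUb_section x) fun y => hC (x, y)
    have h₃ := mul_le_mul_of_nonneg_left hM hC₀
    have h₄ := mul_le_mul_of_nonneg_left hM' hC₀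
    have h₅ := abs_sub (ν fun y => f (x, y)) (ν' fun y => f (x, y))
    linarith
  · refine (abs_abs_sub_abs_le_abs_sub _ _).trans ?_
    have h₁ := abs_le.1 (hf.abs_apply_section_sub_le hν hpos hM hr hd)
    have h₂ := abs_le.1 (hf.abs_apply_section_sub_le hν' hpos' hM' hr hd)
    exact abs_le.2 ⟨by linarith, by linarith⟩

/-- Joint weak-* continuity of the direct product on positive functionals, tested on a single
semiuniform function. -/
lemma Semiuniform.exists_abs_dirProd_sub_lt (hf : Semiuniform f)
    {μ₀ : (X → ℝ) → ℝ} {ν₀ : (Y → ℝ) → ℝ} (hμ₀ : IsMeas μ₀) (hμ₀u : IsUniformMeasure μ₀)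
    (hν₀ : IsMeas ν₀) (hν₀pos : IsPositive ν₀) {ε : ℝ} (hε : 0 < ε) :
    ∃ (H₁ : Finset (X → ℝ)) (H₂ : Finset (Y → ℝ)) (δ : ℝ),
      (∀ h ∈ H₁, IsUb h) ∧ (∀ h ∈ H₂, IsUb h) ∧ 0 < δ ∧
      ∀ μ ν : _, IsMeas μ → IsPositive μ → IsMeas ν → IsPositive ν →
        (∀ h ∈ H₁, |μ h - μ₀ h| < δ) → (∀ h ∈ H₂, |ν h - ν₀ h| < δ) →
        |dirProd μ ν f - dirProd μ₀ ν₀ f| < ε := by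
  classical
  obtain ⟨C, hC₀, hC⟩ : ∃ C : ℝ, 0 ≤ C ∧ ∀ p, |f p| ≤ C := by
    obtain ⟨C, hC⟩ := hf.1
    exact ⟨|C|, abs_nonneg C, fun p => (hC p).trans (le_abs_self C)⟩
  set M := ν₀ (fun _ => 1) + 1 with hMdef
  have h1 : 0 ≤ ν₀ (fun _ => 1) := hν₀pos _ (isUb_const 1) fun _ => zero_le_one
  have hM : 0 < M := by linarith
  set H := sectionLipschitz f (2 * C * M) (2 * M)
  have h0 : (0 : X → ℝ) ∈ H :=
    ⟨fun x => ⟨le_rfl, by simp only [Pi.zero_apply]; positivity⟩, fun x x' r hr _ => by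
      simp only [Pi.zero_apply, sub_zero, abs_zero]; positivity⟩
  obtain ⟨K, δ₁, hδ₁, hK⟩ := hμ₀u H
    ⟨2 * C * M, fun h hh x => by rw [abs_of_nonneg (hh.1 x).1]; exact (hh.1 x).2⟩
    (hf.uniformEquicontinuous_sectionLipschitz _ (by positivity)) 0 h0 (ε / 3) (by positivity)
  let S : Set (X → ℝ) := {h ∈ H | ∀ k ∈ K, h k ≤ δ₁ / 2}
  have h0S : (0 : X → ℝ) ∈ S := ⟨h0, fun k _ => by simp only [Pi.zero_apply]; positivity⟩
  have hne : Nonempty S := ⟨⟨0, h0S⟩⟩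
  let g : X → ℝ := fun x => ⨆ h : S, h.1 x
  have hg : g ∈ H := iSup_mem_sectionLipschitz ⟨0, h0S⟩ fun h hh => hh.1
  have hgub : IsUb g := hf.isUb_of_mem_sectionLipschitz (by positivity) hg
  have hle (h : X → ℝ) (hh : h ∈ S) (x : X) : h x ≤ g x :=
    le_ciSup (f := fun h : S => h.1 x)
      ⟨2 * C * M, by rintro _ ⟨h, rfl⟩; exact (h.2.1.1 x).2⟩ ⟨h, hh⟩
  have hgμ₀ : μ₀ g < ε / 3 := by
    have := hK g hg fun k hk => by
      rw [Pi.zero_apply, sub_zero, abs_of_nonneg (hg.1 k).1]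
      exact (ciSup_le fun h : S => h.2.2 k hk).trans_lt (half_lt_self hδ₁)
    rw [hμ₀.map_zero, sub_zero] at this
    exact lt_of_abs_lt this
  have hφ₀ := hf.isUb_apply_section hν₀ hν₀pos
  refine ⟨{fun x => ν₀ fun y => f (x, y), g},
    insert (fun _ => 1) (K.image fun x y => f (x, y)), min 1 (min (δ₁ / 2) (ε / 3)),
    by simp [hφ₀, hgub], ?_, by positivity, ?_⟩
  · intro h hh
    obtain rfl | hh := Finset.mem_insert.1 hh
    · exact isUb_const 1
    · obtain ⟨x, -, rfl⟩ := Finset.mem_image.1 hh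
      exact hf.isUb_section x
  intro μ ν hμ hμpos hν hνpos h₁ h₂
  have hφ := hf.isUb_apply_section hν hνpos
  simp only [lt_min_iff] at h₁ h₂
  have hνM : ν (fun _ => 1) ≤ M := by
    have := lt_of_abs_lt (h₂ _ (Finset.mem_insert_self _ _)).1
    linarith
  have hψ : (fun x => |ν (fun y => f (x, y)) - ν₀ (fun y => f (x, y))|) ∈ S :=
    ⟨hf.abs_sub_mem_sectionLipschitz hC₀ hC hν hνpos hνM hν₀ hν₀pos (by linarith),
      fun k hk => (h₂ _ (Finset.mem_insert_of_mem (Finset.mem_image_of_mem _ hk))).2.1.le⟩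
  have hμψ := hμpos.abs_le hμ (hφ.sub hφ₀) hgub (hle _ hψ)
  rw [hμ.map_sub hφ hφ₀] at hμψ
  have hμg := (abs_lt.1 (h₁ g (by simp)).2.2).2
  have hμφ₀ := (h₁ (fun x => ν₀ fun y => f (x, y)) (by simp)).2.2
  unfold dirProd
  refine (abs_sub_le _ (μ fun x => ν₀ fun y => f (x, y)) _).trans_lt ?_
  linarith

end Semiuniform

theorem stmt6 {X Y : Type*} [UniformSpace X] [UniformSpace Y]
    (μ₀ : (X → ℝ) → ℝ) (ν₀ : (Y → ℝ) → ℝ)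
    (hμ₀ : IsMeas μ₀) (hμ₀pos : IsPositive μ₀) (hμ₀u : IsUniformMeasure μ₀)
    (hν₀ : IsMeas ν₀) (hν₀pos : IsPositive ν₀)
    (F : Finset (X × Y → ℝ)) (hF : ∀ f ∈ F, Semiuniform f)
    (ε : ℝ) (hε : 0 < ε) :
    ∃ (H₁ : Finset (X → ℝ)) (H₂ : Finset (Y → ℝ)) (δ : ℝ),
      (∀ h ∈ H₁, IsUb h) ∧ (∀ h ∈ H₂, IsUb h) ∧ 0 < δ ∧
      ∀ μ ν : _, IsMeas μ → IsPositive μ → IsMeas ν → IsPositive ν →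
        (∀ h ∈ H₁, |μ h - μ₀ h| < δ) → (∀ h ∈ H₂, |ν h - ν₀ h| < δ) →
        ∀ f ∈ F, |dirProd μ ν f - dirProd μ₀ ν₀ f| < ε := by
  classical
  induction F using Finset.induction_on with
  | empty => exact ⟨∅, ∅, 1, by simp, by simp, one_pos, by simp⟩
  | insert f F _ ih =>
    obtain ⟨H₁, H₂, δ, hH₁, hH₂, hδ, H⟩ := ih fun f' hf' => hF f' (Finset.mem_insert_of_mem hf')
    obtain ⟨H₁', H₂', δ', hH₁', hH₂', hδ', H'⟩ :=
      (hF f (Finset.mem_insert_self f F)).exists_abs_dirProd_sub_lt hμ₀ hμ₀u hν₀ hν₀pos hε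
    refine ⟨H₁ ∪ H₁', H₂ ∪ H₂', min δ δ', fun h hh => (Finset.mem_union.1 hh).elim (hH₁ h) (hH₁' h),
      fun h hh => (Finset.mem_union.1 hh).elim (hH₂ h) (hH₂' h), lt_min hδ hδ', ?_⟩
    intro μ ν hμ hμpos hν hνpos h₁ h₂ f' hf'
    obtain rfl | hf' := Finset.mem_insert.1 hf'
    · exact H' μ ν hμ hμpos hν hνpos
        (fun h hh => (h₁ h (Finset.mem_union_right _ hh)).trans_le (min_le_right _ _))
        (fun h hh => (h₂ h (Finset.mem_union_right _ hh)).trans_le (min_le_right _ _))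
    · exact H μ ν hμ hμpos hν hνpos
        (fun h hh => (h₁ h (Finset.mem_union_left _ hh)).trans_le (min_le_left _ _))
        (fun h hh => (h₂ h (Finset.mem_union_left _ hh)).trans_le (min_le_left _ _)) f' hf'
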